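/- arXiv:2110.15503 — 3 statements merged into one kernel-verified Lean document; each statement's English description precedes it below -/
import Mathlib

section
/- Let X be a finite nonempty type, let p : X → ℝ be a probability mass function (p x ≥ 0 for all x and ∑_x p x = 1), and let the label space be Bool. Let b, t : X → Bool → ℝ be conditional probability mass functions (for each x: values nonnegative and summing to 1 over labels), with b x l > 0 for all x, l. Let K : ℕ, let c : Fin K → X → Bool → ℝ be constraint functions and λ : Fin K → ℝ coefficients. Define w̃ x l = exp (∑_k λ k * c k x l) and the normalized weight w x l = w̃ x l / (∑_{l'} w̃ x l'). Assume the Proposition-2 relation: for every x and l, t x l = b x l * w̃ x l / (∑_{l'} b x l' * w̃ x l'). Define φ x = ∑_l w x l * b x l and C = ∑_x p x * φ x, and assume C > 0; define p̃ x = p x * φ x / C. Then for every loss function L : X → Bool → ℝ, ∑_x ∑_l p x * b x l * w x l * L x l = C * ∑_x ∑_l p̃ x * t x l * L x l; i.e., training on the weighted objective under the biased labels equals C times the objective under the true labels with feature distribution p̃. -/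
/-- Theorem 1 of the paper (finite setting): training on the weighted objective with
biased labels `b` and weights `w` equals `C` times the objective under the true
labels `t` with reweighted feature distribution `p̃`. -/
theorem weighted_loss_unbiased
    {X : Type*} [Fintype X] [Nonempty X]
    (p : X → ℝ) (hp0 : ∀ x, 0 ≤ p x) (hp1 : ∑ x, p x = 1)
    (b t : X → Bool → ℝ)
    (hb0 : ∀ x l, 0 < b x l) (hb1 : ∀ x, ∑ l, b x l = 1)
    (ht0 : ∀ x l, 0 ≤ t x l) (ht1 : ∀ x, ∑ l, t x l = 1)
    (K : ℕ) (c : Fin K → X → Bool → ℝ) (lam : Fin K → ℝ)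
    (wt : X → Bool → ℝ)
    (hwt : ∀ x l, wt x l = Real.exp (∑ k, lam k * c k x l))
    (w : X → Bool → ℝ)
    (hw : ∀ x l, w x l = wt x l / ∑ l', wt x l')
    -- Proposition-2 relation between the true and biased label functions
    (hprop : ∀ x l, t x l = b x l * wt x l / ∑ l', b x l' * wt x l')
    (φ : X → ℝ) (hφ : ∀ x, φ x = ∑ l, w x l * b x l)
    (C : ℝ) (hC : C = ∑ x, p x * φ x) (hCpos : 0 < C)
    (ptil : X → ℝ) (hptil : ∀ x, ptil x = p x * φ x / C) :
    ∀ L : X → Bool → ℝ,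
      ∑ x, ∑ l, p x * b x l * w x l * L x l
        = C * ∑ x, ∑ l, ptil x * t x l * L x l := by
  intro L
  have hpos : ∀ x l, 0 < wt x l := fun x l => hwt x l ▸ Real.exp_pos _
  have key : ∀ x l, φ x * t x l = b x l * w x l := by
    intro x l
    have hS : ∑ l', wt x l' ≠ 0 :=
      (Finset.sum_pos (fun l' _ => hpos x l') Finset.univ_nonempty).ne'
    have hT : ∑ l', b x l' * wt x l' ≠ 0 :=
      (Finset.sum_pos (fun l' _ => mul_pos (hb0 x l') (hpos x l')) Finset.univ_nonempty).ne'
    have hφx : φ x = (∑ l', b x l' * wt x l') / ∑ l', wt x l' := by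
      rw [hφ, Finset.sum_div]
      exact Finset.sum_congr rfl fun l' _ => by rw [hw]; ring
    rw [hφx, hprop, hw]
    field_simp
  simp_rw [Finset.mul_sum]
  refine Finset.sum_congr rfl fun x _ => Finset.sum_congr rfl fun l _ => ?_
  calc p x * b x l * w x l * L x l = p x * (φ x * t x l) * L x l := by rw [key]; ring
    _ = C * (ptil x * t x l * L x l) := by
      rw [hptil]
      field_simp
end

section
/- Let X be a finite nonempty type with label space Bool. Let b, t : X → Bool → ℝ be conditional probability mass functions (for each x: values nonnegative and summing to 1 over labels), with b x l > 0 for all x, l. Let K : ℕ, c : Fin K → X → Bool → ℝ, and λ : Fin K → ℝ. Define w̃ x l = exp (∑_k λ k * c k x l), w x l = w̃ x l / (∑_{l'} w̃ x l'), and φ x = ∑_l w x l * b x l. Assume that for every x and l, t x l = b x l * w̃ x l / (∑_{l'} b x l' * w̃ x l'). Then for every x and l, w x l * b x l = φ x * t x l. -/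
/-- The key pointwise identity in the proof of Theorem 1: weighting the biased
label function `b` by the normalized weights `w` reproduces the true label
function `t` up to the `x`-dependent factor `φ x`. -/
theorem weighted_bias_eq_phi_mul_true
    {X : Type*} [Fintype X] [Nonempty X]
    (b t : X → Bool → ℝ)
    (hb0 : ∀ x l, 0 < b x l) (hb1 : ∀ x, ∑ l, b x l = 1)
    (ht0 : ∀ x l, 0 ≤ t x l) (ht1 : ∀ x, ∑ l, t x l = 1)
    (K : ℕ) (c : Fin K → X → Bool → ℝ) (lam : Fin K → ℝ)
    (wt : X → Bool → ℝ)
    (hwt : ∀ x l, wt x l = Real.exp (∑ k, lam k * c k x l))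
    (w : X → Bool → ℝ)
    (hw : ∀ x l, w x l = wt x l / ∑ l', wt x l')
    (φ : X → ℝ) (hφ : ∀ x, φ x = ∑ l, w x l * b x l)
    (hprop : ∀ x l, t x l = b x l * wt x l / ∑ l', b x l' * wt x l') :
    ∀ x l, w x l * b x l = φ x * t x l := by
  intro x l
  have hwt_pos : ∀ l, 0 < wt x l := fun l => by rw [hwt]; exact Real.exp_pos _
  have hsum : 0 < ∑ l', b x l' * wt x l' :=
    Finset.sum_pos (fun l _ => mul_pos (hb0 x l) (hwt_pos l)) Finset.univ_nonempty
  have hφ_eq : φ x = (∑ l', b x l' * wt x l') / ∑ l', wt x l' := by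
    rw [hφ, Finset.sum_div]
    refine Finset.sum_congr rfl fun l _ => ?_
    rw [hw]
    ring
  rw [hφ_eq, hprop, hw, div_mul_div_comm, mul_comm (∑ l', wt x l'),
    mul_div_mul_left _ _ hsum.ne']
  ring
end

section
/- Let X be a finite nonempty type with label space Bool, let p : X → ℝ be a probability mass function, and let t : X → Bool → ℝ be a conditional probability mass function with t x l > 0 for all x, l. Let K : ℕ, c : Fin K → X → Bool → ℝ, and λ : Fin K → ℝ. Define Z x = ∑_l t x l * exp (∑_k λ k * c k x l) and h x l = t x l * exp (∑_k λ k * c k x l) / Z x. Then h is a conditional probability mass function, and for every conditional probability mass function r : X → Bool → ℝ (for each x: r x l ≥ 0 and ∑_l r x l = 1) satisfying the joint linear constraints ∑_x ∑_l p x * r x l * c k x l = ∑_x ∑_l p x * h x l * c k x l for all k, the expected conditional KL divergence satisfies ∑_x p x * (∑_l r x l * log (r x l / t x l)) ≥ ∑_x p x * (∑_l h x l * log (h x l / t x l)), with equality if and only if r x = h x for every x with p x > 0. -/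
/-- A Kullback-Leibler divergence between finite distributions, as a sum of nonnegative terms. -/
theorem sum_mul_log_div_eq_sum_mul_klFun {ι : Type*} [Fintype ι] (q h : ι → ℝ)
    (hpos : ∀ i, 0 < h i) (hsum : ∑ i, q i = ∑ i, h i) :
    ∑ i, q i * Real.log (q i / h i) = ∑ i, h i * InformationTheory.klFun (q i / h i) := by
  have key : ∀ i, h i * InformationTheory.klFun (q i / h i)
      = q i * Real.log (q i / h i) + (h i - q i) := by
    intro i
    have := (hpos i).ne'
    rw [InformationTheory.klFun_apply]
    field_simp
    ring
  simp only [key, Finset.sum_add_distrib, Finset.sum_sub_distrib, hsum, sub_self, add_zero]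

/-- The Gibbs inequality for finite distributions. -/
theorem sum_mul_log_div_nonneg {ι : Type*} [Fintype ι] (q h : ι → ℝ)
    (hq : ∀ i, 0 ≤ q i) (hpos : ∀ i, 0 < h i) (hsum : ∑ i, q i = ∑ i, h i) :
    0 ≤ ∑ i, q i * Real.log (q i / h i) := by
  rw [sum_mul_log_div_eq_sum_mul_klFun q h hpos hsum]
  exact Finset.sum_nonneg fun i _ => mul_nonneg (hpos i).le
    (InformationTheory.klFun_nonneg (div_nonneg (hq i) (hpos i).le))

/-- The equality case of the Gibbs inequality. -/
theorem sum_mul_log_div_eq_zero_iff {ι : Type*} [Fintype ι] (q h : ι → ℝ)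
    (hq : ∀ i, 0 ≤ q i) (hpos : ∀ i, 0 < h i) (hsum : ∑ i, q i = ∑ i, h i) :
    ∑ i, q i * Real.log (q i / h i) = 0 ↔ q = h := by
  have hdiv : ∀ i, 0 ≤ q i / h i := fun i => div_nonneg (hq i) (hpos i).le
  rw [sum_mul_log_div_eq_sum_mul_klFun q h hpos hsum,
    Finset.sum_eq_zero_iff_of_nonneg fun i _ => mul_nonneg (hpos i).le
      (InformationTheory.klFun_nonneg (hdiv i)), funext_iff]
  refine forall_congr' fun i => ?_
  rw [mul_eq_zero, or_iff_right (hpos i).ne', InformationTheory.klFun_eq_zero_iff (hdiv i),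
    div_eq_one_iff_eq (hpos i).ne']
  simp

/-- Relative to an exponential tilt `h` of `t`, the divergence to `t` splits into the divergence
to `h` plus the mean of the tilting exponent, up to a normalization constant. -/
theorem sum_mul_log_div_of_tilt {ι : Type*} [Fintype ι] (q t h s : ι → ℝ) (z : ℝ)
    (ht : ∀ i, 0 < t i) (hz : 0 < z) (hh : ∀ i, h i = t i * Real.exp (s i) / z)
    (hq : ∑ i, q i = 1) :
    ∑ i, q i * Real.log (q i / t i)
      = ∑ i, q i * Real.log (q i / h i) + ∑ i, q i * s i - Real.log z := by
  have key : ∀ i, q i * Real.log (q i / t i)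
      = q i * Real.log (q i / h i) + q i * s i - q i * Real.log z := by
    intro i
    rcases eq_or_ne (q i) 0 with h0 | h0
    · simp [h0]
    · have h1 := (ht i).ne'
      have h2 := (Real.exp_pos (s i)).ne'
      rw [hh, Real.log_div h0 h1, Real.log_div h0 (by positivity),
        Real.log_div (by positivity) hz.ne', Real.log_mul h1 h2, Real.log_exp]
      ring
  simp only [key, Finset.sum_add_distrib, Finset.sum_sub_distrib, ← Finset.sum_mul, hq, one_mul]

/-- Optimality statement behind Proposition 2: among all conditional label
functions satisfying the expected pairwise constraints, the conditional
distribution obtained by exponentially tilting `t` minimizes the expected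
conditional KL divergence to `t`, with equality iff they agree wherever `p` is
positive. -/
theorem conditional_exponential_tilting_minimizes_expected_KL
    {X : Type*} [Fintype X] [Nonempty X]
    (p : X → ℝ) (hp0 : ∀ x, 0 ≤ p x) (hp1 : ∑ x, p x = 1)
    (t : X → Bool → ℝ)
    (ht0 : ∀ x l, 0 < t x l) (ht1 : ∀ x, ∑ l, t x l = 1)
    (K : ℕ) (c : Fin K → X → Bool → ℝ) (lam : Fin K → ℝ)
    (Z : X → ℝ)
    (hZ : ∀ x, Z x = ∑ l, t x l * Real.exp (∑ k, lam k * c k x l))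
    (h : X → Bool → ℝ)
    (hh : ∀ x l, h x l = t x l * Real.exp (∑ k, lam k * c k x l) / Z x) :
    ((∀ x l, 0 ≤ h x l) ∧ ∀ x, ∑ l, h x l = 1) ∧
      ∀ r : X → Bool → ℝ, (∀ x l, 0 ≤ r x l) → (∀ x, ∑ l, r x l = 1) →
        (∀ k, ∑ x, ∑ l, p x * r x l * c k x l = ∑ x, ∑ l, p x * h x l * c k x l) →
        (∑ x, p x * ∑ l, h x l * Real.log (h x l / t x l))
            ≤ ∑ x, p x * ∑ l, r x l * Real.log (r x l / t x l) ∧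
          ((∑ x, p x * ∑ l, r x l * Real.log (r x l / t x l))
              = (∑ x, p x * ∑ l, h x l * Real.log (h x l / t x l))
            ↔ ∀ x, 0 < p x → r x = h x) := by
  have hZpos : ∀ x, 0 < Z x := fun x => by
    rw [hZ]
    exact Finset.sum_pos (fun l _ => mul_pos (ht0 x l) (Real.exp_pos _)) Finset.univ_nonempty
  have hpos : ∀ x l, 0 < h x l := fun x l => by
    rw [hh]
    exact div_pos (mul_pos (ht0 x l) (Real.exp_pos _)) (hZpos x)
  have hsum : ∀ x, ∑ l, h x l = 1 := fun x => by
    simp only [hh]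
    rw [← Finset.sum_div, ← hZ, div_self (hZpos x).ne']
  refine ⟨⟨fun x l => (hpos x l).le, hsum⟩, fun r hr0 hr1 hc => ?_⟩
  have hmean : ∀ q : X → Bool → ℝ, ∑ x, p x * ∑ l, q x l * ∑ k, lam k * c k x l
      = ∑ k, lam k * ∑ x, ∑ l, p x * q x l * c k x l := by
    intro q
    simp only [Finset.mul_sum]
    symm
    rw [Finset.sum_comm]
    refine Finset.sum_congr rfl fun x _ => ?_
    rw [Finset.sum_comm]
    refine Finset.sum_congr rfl fun l _ => Finset.sum_congr rfl fun k _ => ?_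
    ring
  have hsplit : ∀ q : X → Bool → ℝ, (∀ x, ∑ l, q x l = 1) →
      ∑ x, p x * ∑ l, q x l * Real.log (q x l / t x l)
        = ∑ x, p x * ∑ l, q x l * Real.log (q x l / h x l)
          + ∑ k, lam k * ∑ x, ∑ l, p x * q x l * c k x l - ∑ x, p x * Real.log (Z x) := by
    intro q hq
    rw [← hmean, ← Finset.sum_add_distrib, ← Finset.sum_sub_distrib]
    refine Finset.sum_congr rfl fun x _ => ?_
    rw [sum_mul_log_div_of_tilt (q x) (t x) (h x) _ (Z x) (ht0 x) (hZpos x) (hh x) (hq x)]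
    ring
  have hself : ∑ x, p x * ∑ l, h x l * Real.log (h x l / h x l) = 0 := by
    simp [div_self (hpos _ _).ne']
  have hpyth : ∑ x, p x * ∑ l, r x l * Real.log (r x l / t x l)
      = ∑ x, p x * ∑ l, h x l * Real.log (h x l / t x l)
        + ∑ x, p x * ∑ l, r x l * Real.log (r x l / h x l) := by
    rw [hsplit r hr1, hsplit h hsum, hself]
    simp only [hc]
    ring
  have hmass : ∀ x, ∑ l, r x l = ∑ l, h x l := fun x => (hr1 x).trans (hsum x).symm
  have hterm : ∀ x ∈ Finset.univ, 0 ≤ p x * ∑ l, r x l * Real.log (r x l / h x l) := fun x _ =>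
    mul_nonneg (hp0 x) (sum_mul_log_div_nonneg (r x) (h x) (hr0 x) (hpos x) (hmass x))
  rw [hpyth]
  refine ⟨le_add_of_nonneg_right (Finset.sum_nonneg hterm), ?_⟩
  rw [add_eq_left, Finset.sum_eq_zero_iff_of_nonneg hterm]
  refine forall_congr' fun x => ?_
  rw [mul_eq_zero, sum_mul_log_div_eq_zero_iff (r x) (h x) (hr0 x) (hpos x) (hmass x),
    (hp0 x).lt_iff_ne']
  simp only [Finset.mem_univ, true_imp_iff, or_iff_not_imp_left, ne_eq]
end
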